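/- Let s = (q⃗, w⃗) ∈ RS(S) be a reachable configuration of the composed system S = S1 ⋈_{H,K} S2. If q_H ∉ Q̂_H then the restriction s↾1 is a reachable configuration of S1 (s↾1 ∈ RS(S1)); symmetrically, if q_K ∉ Q̂_K then s↾2 ∈ RS(S2). -/

import Mathlib

/- Common formalization of Communicating Finite State Machines (CFSMs),
communicating systems, gateways and their composition, following
"Global Types with Internal Delegation" / GTIR paper definitions. -/

namespace GTIR

/-- Polarity of an action: `!` (send) or `?` (receive). -/
inductive Pol : Type
  | bang
  | query
deriving DecidableEq

/-- Dual polarity: swap `!` and `?`. -/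
def Pol.dual : Pol → Pol
  | .bang => .query
  | .query => .bang

/-- Actions over roles `R` and messages `A`:
`snd s r a` is `sr!a` (s sends `a` to r), `rcv s r a` is `sr?a`
(r receives/consumes `a` sent by s). -/
inductive Act (R A : Type) : Type
  | snd : R → R → A → Act R A
  | rcv : R → R → A → Act R A

/-- The action is a send action. -/
def Act.isSend {R A : Type} : Act R A → Prop
  | .snd _ _ _ => True
  | .rcv _ _ _ => False

/-- The action is a receive action. -/
def Act.isRecv {R A : Type} : Act R A → Prop
  | .snd _ _ _ => False
  | .rcv _ _ _ => True

/-- Erase the channel name of an action: `pq!a ↦ !a`, `pq?a ↦ ?a`. -/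
def Act.noC {R A : Type} : Act R A → Pol × A
  | .snd _ _ a => (.bang, a)
  | .rcv _ _ a => (.query, a)

/-- The dual of a word over `{!,?} × A`: swap `!` and `?` pointwise. -/
def dualWord {A : Type} (w : List (Pol × A)) : List (Pol × A) :=
  w.map fun x => (x.1.dual, x.2)

/-- Universal state type: base states from `B`, plus arbitrarily nested fresh
"hat" states (one for each transition) used by the gateway construction. -/
inductive St (R A B : Type) : Type
  | base : B → St R A B
  | hat : St R A B → Act R A → St R A B → St R A B

/-- A communicating finite state machine over roles `R` and messages `A`,
with states taken from `St R A B`: an initial state together with a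
transition relation. -/
structure CFSM (R A B : Type) where
  init : St R A B
  delta : Set (St R A B × Act R A × St R A B)

namespace CFSM

variable {R A B : Type}

/-- A state is final if it has no outgoing transition. -/
def Final (M : CFSM R A B) (q : St R A B) : Prop :=
  ∀ l q', (q, l, q') ∉ M.delta

/-- A sending state: non-final, and all outgoing transitions are sends. -/
def Sending (M : CFSM R A B) (q : St R A B) : Prop :=
  (∃ l q', (q, l, q') ∈ M.delta) ∧ ∀ l q', (q, l, q') ∈ M.delta → l.isSend

/-- A receiving state: non-final, and all outgoing transitions are receives. -/
def Receiving (M : CFSM R A B) (q : St R A B) : Prop :=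
  (∃ l q', (q, l, q') ∈ M.delta) ∧ ∀ l q', (q, l, q') ∈ M.delta → l.isRecv

/-- A mixed state: it has both an outgoing send and an outgoing receive. -/
def Mixed (M : CFSM R A B) (q : St R A B) : Prop :=
  (∃ l q', (q, l, q') ∈ M.delta ∧ l.isSend) ∧
  (∃ l q', (q, l, q') ∈ M.delta ∧ l.isRecv)

/-- `M` has no mixed states. -/
def NoMixed (M : CFSM R A B) : Prop := ∀ q, ¬ M.Mixed q

/-- `?`-determinism: two receives of the same message from the same state
(possibly on different channels) have the same target. -/
def QDet (M : CFSM R A B) : Prop :=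
  ∀ q a s r s' r' q' q'', (q, Act.rcv s r a, q') ∈ M.delta →
    (q, Act.rcv s' r' a, q'') ∈ M.delta → q' = q''

/-- `!`-determinism: two sends of the same message from the same state
(possibly on different channels) have the same target. -/
def BDet (M : CFSM R A B) : Prop :=
  ∀ q a s r s' r' q' q'', (q, Act.snd s r a, q') ∈ M.delta →
    (q, Act.snd s' r' a, q'') ∈ M.delta → q' = q''

/-- `?!`-determinism. -/
def IODet (M : CFSM R A B) : Prop := M.QDet ∧ M.BDet

/-- Accepting runs from a given state (every state is accepting). -/
inductive Accepts (M : CFSM R A B) : St R A B → List (Act R A) → Prop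
  | nil (q : St R A B) : Accepts M q []
  | cons {q : St R A B} {l : Act R A} {q' : St R A B} {φ : List (Act R A)} :
      (q, l, q') ∈ M.delta → Accepts M q' φ → Accepts M q (l :: φ)

/-- The language of `M` over `Act`. -/
def lang (M : CFSM R A B) : Set (List (Act R A)) := {φ | M.Accepts M.init φ}

/-- The language of `M` with channel names erased. -/
def langNoC (M : CFSM R A B) : Set (List (Pol × A)) :=
  (fun φ => φ.map Act.noC) '' M.lang

/-- Compatibility `M ↔ M'`: the channel-erased language of `M` is the set of
duals of the channel-erased language of `M'`; moreover neither machine has a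
mixed state and both are `?!`-deterministic. -/
def Compat (M M' : CFSM R A B) : Prop :=
  M.langNoC = dualWord '' M'.langNoC ∧
  M.NoMixed ∧ M'.NoMixed ∧ M.IODet ∧ M'.IODet

/-- The machine of role `p` over the role set `P`: every transition label is
an action of `p` (a send `pr!a` or a receive `rp?a`) with partner `r ∈ P`. -/
def ActsFor (M : CFSM R A B) (p : R) (P : Set R) : Prop :=
  ∀ q l q', (q, l, q') ∈ M.delta →
    ∃ r a, r ∈ P ∧ r ≠ p ∧ (l = Act.snd p r a ∨ l = Act.rcv r p a)

/-- All states occurring in `M` are base states; this guarantees that the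
intermediate "hat" states of the gateway construction are fresh for `M`. -/
def HatFree (M : CFSM R A B) : Prop :=
  (∃ b, M.init = St.base b) ∧
  ∀ q l q', (q, l, q') ∈ M.delta →
    (∃ b, q = St.base b) ∧ (∃ b, q' = St.base b)

/-- The set `Q̂` of fresh intermediate gateway states of `M`
(one for each transition of `M`). -/
def hatStates (M : CFSM R A B) : Set (St R A B) :=
  {x | ∃ q l q', (q, l, q') ∈ M.delta ∧ x = St.hat q l q'}

/-- The gateway `gw(M_H, K)` of the machine `M` of role `H` towards role `K`:
each transition `t = (q, Hs!a, q')` of `M` is replaced by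
`(q, KH?a, q̂_t)` and `(q̂_t, Hs!a, q')`, and each transition
`t = (q, sH?a, q')` of `M` is replaced by `(q, sH?a, q̂_t)` and
`(q̂_t, HK!a, q')`. -/
def gw (M : CFSM R A B) (H K : R) : CFSM R A B where
  init := M.init
  delta :=
    {x | ∃ q s a q', (q, Act.snd H s a, q') ∈ M.delta ∧
      (x = (q, Act.rcv K H a, St.hat q (Act.snd H s a) q') ∨
       x = (St.hat q (Act.snd H s a) q', Act.snd H s a, q'))} ∪
    {x | ∃ q s a q', (q, Act.rcv s H a, q') ∈ M.delta ∧
      (x = (q, Act.rcv s H a, St.hat q (Act.rcv s H a) q') ∨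
       x = (St.hat q (Act.rcv s H a) q', Act.snd H K a, q'))}

end CFSM

/-- A communicating system: a set of roles together with a CFSM for each role. -/
structure CS (R A B : Type) where
  roles : Set R
  mach : R → CFSM R A B

namespace CS

variable {R A B : Type}

/-- Well-formedness: the machine of each role `p` of the system only carries
actions of `p` with partners among the system's roles. -/
def WF (S : CS R A B) : Prop :=
  ∀ p ∈ S.roles, (S.mach p).ActsFor p S.roles

/-- Each machine of the system has a finite transition relation
(hence finitely many relevant states). -/
def FiniteSys (S : CS R A B) : Prop :=
  ∀ p ∈ S.roles, (S.mach p).delta.Finite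

open scoped Classical in
/-- Composition `S1 ⋈_{H,K} S2`: the union of the two systems, where the
machines of the interface roles `H` and `K` are replaced by the gateways
`gw(M¹_H, K)` and `gw(M²_K, H)`. -/
noncomputable def compose (S1 S2 : CS R A B) (H K : R) : CS R A B where
  roles := S1.roles ∪ S2.roles
  mach := fun p =>
    if p = H then (S1.mach H).gw H K
    else if p = K then (S2.mach K).gw K H
    else if p ∈ S1.roles then S1.mach p
    else S2.mach p

end CS

/-- A configuration: a local state for every role and a buffer (word over the
messages) for every ordered channel. -/
structure Config (R A B : Type) where
  st : R → St R A B
  buf : R → R → List A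

/-- The initial configuration(s) of a system: every machine of the system is
in its initial state and all the system's buffers are empty. -/
def InitConf {R A B : Type} (S : CS R A B) (c : Config R A B) : Prop :=
  (∀ p ∈ S.roles, c.st p = (S.mach p).init) ∧
  (∀ p ∈ S.roles, ∀ q ∈ S.roles, c.buf p q = [])

/-- One asynchronous step of system `S`, labelled by an action:
a send `sr!a` appends `a` to the buffer of channel `sr`, a receive `sr?a`
removes `a` from the front of the buffer of channel `sr`; everything else is
unchanged. -/
def Step {R A B : Type} (S : CS R A B) (c : Config R A B) :
    Act R A → Config R A B → Prop
  | .snd s r a, c' =>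
      s ∈ S.roles ∧ (c.st s, Act.snd s r a, c'.st s) ∈ (S.mach s).delta ∧
      (∀ p, p ≠ s → c'.st p = c.st p) ∧
      c'.buf s r = c.buf s r ++ [a] ∧
      (∀ p q, ¬(p = s ∧ q = r) → c'.buf p q = c.buf p q)
  | .rcv s r a, c' =>
      r ∈ S.roles ∧ (c.st r, Act.rcv s r a, c'.st r) ∈ (S.mach r).delta ∧
      (∀ p, p ≠ r → c'.st p = c.st p) ∧
      c.buf s r = a :: c'.buf s r ∧
      (∀ p q, ¬(p = s ∧ q = r) → c'.buf p q = c.buf p q)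

/-- `RS(S)`: the configurations reachable from the initial configuration. -/
def Reach {R A B : Type} (S : CS R A B) (c : Config R A B) : Prop :=
  ∃ c₀, InitConf S c₀ ∧
    Relation.ReflTransGen (fun x y => ∃ l, Step S x l y) c₀ c

/-- Deadlock configuration: all the system's buffers are empty and every
machine is in a receiving state. -/
def DeadlockConf {R A B : Type} (S : CS R A B) (c : Config R A B) : Prop :=
  (∀ p ∈ S.roles, ∀ q ∈ S.roles, c.buf p q = []) ∧
  ∀ p ∈ S.roles, (S.mach p).Receiving (c.st p)

/-- A system is deadlock-free if no reachable configuration is a deadlock. -/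
def DeadlockFree {R A B : Type} (S : CS R A B) : Prop :=
  ∀ c, Reach S c → ¬ DeadlockConf S c

/-- Orphan-message configuration: every machine is in a final state but some
buffer of the system is non-empty. -/
def OrphanConf {R A B : Type} (S : CS R A B) (c : Config R A B) : Prop :=
  (∀ p ∈ S.roles, (S.mach p).Final (c.st p)) ∧
  ∃ p ∈ S.roles, ∃ q ∈ S.roles, c.buf p q ≠ []

/-- Unspecified reception configuration: some machine is in a receiving state
but each of its expected input buffers is non-empty and starts with a message
it cannot receive. -/
def UnspecConf {R A B : Type} (S : CS R A B) (c : Config R A B) : Prop :=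
  ∃ r ∈ S.roles, (S.mach r).Receiving (c.st r) ∧
    ∀ s a q', (c.st r, Act.rcv s r a, q') ∈ (S.mach r).delta →
      c.buf s r ≠ [] ∧ ∀ w, c.buf s r ≠ a :: w

/-- A system is safe if no reachable configuration is a deadlock,
an orphan-message, or an unspecified reception configuration. -/
def Safe {R A B : Type} (S : CS R A B) : Prop :=
  ∀ c, Reach S c →
    ¬ DeadlockConf S c ∧ ¬ OrphanConf S c ∧ ¬ UnspecConf S c

end GTIR

open GTIR

namespace GTIR

variable {R A B : Type}

def unhat : St R A B → St R A B
  | .base b => .base b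
  | .hat q (.snd _ _ _) _ => q
  | .hat _ (.rcv _ _ _) q' => q'

open scoped Classical in
noncomputable def view (H : R) (c : Config R A B) : Config R A B where
  st := fun p => if p = H then unhat (c.st p) else c.st p
  buf := c.buf

def Ag (S : CS R A B) (d c : Config R A B) : Prop :=
  (∀ p ∈ S.roles, d.st p = c.st p) ∧
  (∀ p ∈ S.roles, ∀ q ∈ S.roles, d.buf p q = c.buf p q)

def ReachUp (S : CS R A B) (x : Config R A B) : Prop := ∀ d, Ag S d x → Reach S d

theorem ReachUp.ag {S : CS R A B} {x y : Config R A B} (h : ReachUp S x) (hxy : Ag S y x) :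
    ReachUp S y := fun d hd =>
  h d ⟨fun p hp => (hd.1 p hp).trans (hxy.1 p hp),
    fun p hp q hq => (hd.2 p hp q hq).trans (hxy.2 p hp q hq)⟩

theorem Reach.step {S : CS R A B} {x y : Config R A B} {l} (h : Reach S x) (hs : Step S x l y) :
    Reach S y := by
  obtain ⟨c, hc, hr⟩ := h
  exact ⟨c, hc, hr.tail ⟨l, hs⟩⟩

open scoped Classical in
theorem ReachUp.step {S : CS R A B} (hwf : S.WF) {x y : Config R A B} {l}
    (h : ReachUp S x) (hs : Step S x l y) : ReachUp S y := by
  intro d hd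
  cases l with
  | snd s r a =>
    obtain ⟨hsS, ht, hst, hb, hbo⟩ := hs
    have hr : r ∈ S.roles := by
      obtain ⟨r', a', h1, h2, h3 | h3⟩ := hwf s hsS _ _ _ ht
      · cases h3; exact h1
      · cases h3
    let e : Config R A B := ⟨fun p => if p = s then x.st s else d.st p,
      fun p q => if p = s ∧ q = r then x.buf s r else d.buf p q⟩
    have he : Ag S e x := by
      refine ⟨fun p hp => ?_, fun p hp q hq => ?_⟩
      · by_cases hps : p = s
        · subst hps; simp [e]
        · simp only [e, if_neg hps]; rw [hd.1 p hp, hst p hps]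
      · by_cases hps : p = s ∧ q = r
        · obtain ⟨rfl, rfl⟩ := hps; simp [e]
        · simp only [e, if_neg hps]; rw [hd.2 p hp q hq, hbo p q hps]
    refine (h e he).step (l := .snd s r a) ⟨hsS, ?_, ?_, ?_, ?_⟩
    · simp only [e, if_true]; rw [hd.1 s hsS]; exact ht
    · intro p hp; simp [e, hp]
    · simp only [e, and_self, if_true]; rw [hd.2 s hsS r hr, hb]
    · intro p q hpq; simp only [e, if_neg hpq]
  | rcv s r a =>
    obtain ⟨hrS, ht, hst, hb, hbo⟩ := hs
    have hsS : s ∈ S.roles := by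
      obtain ⟨r', a', h1, h2, h3 | h3⟩ := hwf r hrS _ _ _ ht
      · cases h3
      · cases h3; exact h1
    let e : Config R A B := ⟨fun p => if p = r then x.st r else d.st p,
      fun p q => if p = s ∧ q = r then x.buf s r else d.buf p q⟩
    have he : Ag S e x := by
      refine ⟨fun p hp => ?_, fun p hp q hq => ?_⟩
      · by_cases hps : p = r
        · subst hps; simp [e]
        · simp only [e, if_neg hps]; rw [hd.1 p hp, hst p hps]
      · by_cases hps : p = s ∧ q = r
        · obtain ⟨rfl, rfl⟩ := hps; simp [e]
        · simp only [e, if_neg hps]; rw [hd.2 p hp q hq, hbo p q hps]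
    refine (h e he).step (l := .rcv s r a) ⟨hrS, ?_, ?_, ?_, ?_⟩
    · simp only [e, if_true]; rw [hd.1 r hrS]; exact ht
    · intro p hp; simp [e, hp]
    · simp only [e, and_self, if_true]; rw [hd.2 s hsS r hrS, hb]
    · intro p q hpq; simp only [e, if_neg hpq]

theorem view_st_ne {H p : R} (c : Config R A B) (h : p ≠ H) : (view H c).st p = c.st p := by
  simp [view, h]

theorem view_st_eq {H : R} (c : Config R A B) : (view H c).st H = unhat (c.st H) := by
  simp [view]

/-- What a gateway transition looks like after projecting the hat states. -/
theorem gw_cases {M : CFSM R A B} (hf : M.HatFree) {H K : R} {x l y}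
    (h : (x, l, y) ∈ (M.gw H K).delta) :
    ((unhat x, l, unhat y) ∈ M.delta ∨
      (unhat x = unhat y ∧ ((∃ a, l = .rcv K H a) ∨ (∃ a, l = .snd H K a)))) ∧
    ((∃ b, y = .base b) ∨ y ∈ M.hatStates) := by
  rcases h with ⟨q, s, a, q', ht, h | h⟩ | ⟨q, s, a, q', ht, h | h⟩ <;>
  obtain ⟨⟨b, hb⟩, ⟨b', hb'⟩⟩ := hf.2 _ _ _ ht <;> cases h
  · exact ⟨.inr ⟨by subst hb; rfl, .inl ⟨_, rfl⟩⟩, .inr ⟨_, _, _, ht, rfl⟩⟩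
  · exact ⟨.inl (by subst hb'; exact ht), .inl ⟨_, hb'⟩⟩
  · exact ⟨.inl (by subst hb; exact ht), .inr ⟨_, _, _, ht, rfl⟩⟩
  · exact ⟨.inr ⟨by subst hb'; rfl, .inr ⟨_, rfl⟩⟩, .inl ⟨_, hb'⟩⟩

theorem step_view {S T : CS R A B} {H K : R} (hH : H ∈ S.roles) (hK : K ∉ S.roles)
    (hf : (S.mach H).HatFree) (hTH : T.mach H = (S.mach H).gw H K)
    (hTo : ∀ p ∈ S.roles, p ≠ H → T.mach p = S.mach p) {c c' : Config R A B} {l}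
    (hs : Step T c l c') :
    (Step S (view H c) l (view H c') ∨ Ag S (view H c') (view H c)) ∧
    (c'.st H = c.st H ∨ (∃ b, c'.st H = .base b) ∨ c'.st H ∈ (S.mach H).hatStates) := by
  have key : ∀ p, (∀ p', p' ≠ p → c'.st p' = c.st p') →
      ∀ p', p' ≠ p → (view H c').st p' = (view H c).st p' := by
    intro p h p' hp'
    simp only [view]; rw [h p' hp']
  cases l with
  | snd s r a =>
    obtain ⟨hsT, ht, hst, hb, hbo⟩ := hs
    by_cases hsS : s ∈ S.roles
    · by_cases hsH : s = H
      · subst hsH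
        rw [hTH] at ht
        obtain ⟨h1, h2⟩ := gw_cases hf ht
        refine ⟨?_, .inr h2⟩
        rcases h1 with h1 | ⟨h1, ⟨a', h3⟩ | ⟨a', h3⟩⟩
        · exact .inl ⟨hsS, by rw [view_st_eq, view_st_eq]; exact h1, key _ hst, hb, hbo⟩
        · cases h3
        · cases h3
          refine .inr ⟨fun p hp => ?_, fun p hp q hq => hbo p q ?_⟩
          · by_cases hps : p = s
            · subst hps; rw [view_st_eq, view_st_eq, h1]
            · exact key _ hst p hps
          · rintro ⟨-, rfl⟩; exact hK hq
      · rw [hTo s hsS hsH] at ht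
        exact ⟨.inl ⟨hsS, by rw [view_st_ne _ hsH, view_st_ne _ hsH]; exact ht, key _ hst, hb, hbo⟩,
          .inl (hst _ (Ne.symm hsH))⟩
    · refine ⟨.inr ⟨fun p hp => key _ hst p ?_, fun p hp q hq => hbo p q ?_⟩, .inl (hst _ ?_)⟩
      · rintro rfl; exact hsS hp
      · rintro ⟨rfl, -⟩; exact hsS hp
      · rintro rfl; exact hsS hH
  | rcv r s a =>
    obtain ⟨hsT, ht, hst, hb, hbo⟩ := hs
    by_cases hsS : s ∈ S.roles
    · by_cases hsH : s = H
      · subst hsH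
        rw [hTH] at ht
        obtain ⟨h1, h2⟩ := gw_cases hf ht
        refine ⟨?_, .inr h2⟩
        rcases h1 with h1 | ⟨h1, ⟨a', h3⟩ | ⟨a', h3⟩⟩
        · exact .inl ⟨hsS, by rw [view_st_eq, view_st_eq]; exact h1, key _ hst, hb, hbo⟩
        · cases h3
          refine .inr ⟨fun p hp => ?_, fun p hp q hq => hbo p q ?_⟩
          · by_cases hps : p = s
            · subst hps; rw [view_st_eq, view_st_eq, h1]
            · exact key _ hst p hps
          · rintro ⟨rfl, -⟩; exact hK hp
        · cases h3
      · rw [hTo s hsS hsH] at ht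
        exact ⟨.inl ⟨hsS, by rw [view_st_ne _ hsH, view_st_ne _ hsH]; exact ht, key _ hst, hb, hbo⟩,
          .inl (hst _ (Ne.symm hsH))⟩
    · refine ⟨.inr ⟨fun p hp => key _ hst p ?_, fun p hp q hq => hbo p q ?_⟩, .inl (hst _ ?_)⟩
      · rintro rfl; exact hsS hp
      · rintro ⟨-, rfl⟩; exact hsS hq
      · rintro rfl; exact hsS hH

theorem reach_side {S T : CS R A B} {H K : R} (hH : H ∈ S.roles) (hK : K ∉ S.roles)
    (hwf : S.WF) (hf : (S.mach H).HatFree) (hsub : S.roles ⊆ T.roles)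
    (hTH : T.mach H = (S.mach H).gw H K)
    (hTo : ∀ p ∈ S.roles, p ≠ H → T.mach p = S.mach p) {c : Config R A B}
    (hc : Reach T c) (hn : c.st H ∉ (S.mach H).hatStates) : Reach S c := by
  obtain ⟨c₀, ⟨hi1, hi2⟩, hr⟩ := hc
  have inv : ReachUp S (view H c) ∧
      ((∃ b, c.st H = .base b) ∨ c.st H ∈ (S.mach H).hatStates) := by
    clear hn
    induction hr with
    | refl =>
      obtain ⟨b, hb⟩ := hf.1
      have h0 : c₀.st H = .base b := by rw [hi1 H (hsub hH), hTH]; exact hb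
      refine ⟨fun d hd => ⟨d, ⟨fun p hp => ?_, fun p hp q hq => ?_⟩, .refl⟩, .inl ⟨b, h0⟩⟩
      · rw [hd.1 p hp]
        by_cases hpH : p = H
        · subst hpH; rw [view_st_eq, h0, hb]; rfl
        · rw [view_st_ne _ hpH, hi1 p (hsub hp), hTo p hp hpH]
      · rw [hd.2 p hp q hq]; exact hi2 p (hsub hp) q (hsub hq)
    | tail _ hs ih =>
      obtain ⟨l, hs⟩ := hs
      obtain ⟨h1, h2⟩ := step_view hH hK hf hTH hTo hs
      refine ⟨h1.elim (fun h => ih.1.step hwf h) (fun h => ih.1.ag h), ?_⟩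
      rcases h2 with h2 | h2
      · rw [h2]; exact ih.2
      · exact h2
  obtain ⟨b, hb⟩ := inv.2.resolve_right hn
  refine inv.1 c ⟨fun p _ => ?_, fun _ _ _ _ => rfl⟩
  by_cases hpH : p = H
  · subst hpH; rw [view_st_eq, hb]; rfl
  · rw [view_st_ne _ hpH]

end GTIR

/-- a reachable configuration of the composed system whose
gateway state of `H` is not an intermediate state restricts to a reachable
configuration of `S1`; symmetrically for `K` and `S2`.  (Configurations are
total functions, and reachability in `Si` only constrains the components of
`Si`, so the restriction is rendered by the configuration itself.) -/
theorem stmt4_restriction_reachable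
    {R A B : Type} [Finite R] [Finite A]
    (S1 S2 : CS R A B) (H K : R)
    (hH : H ∈ S1.roles) (hK : K ∈ S2.roles)
    (hdisj : S1.roles ∩ S2.roles = ∅)
    (hcompat : (S1.mach H).Compat (S2.mach K))
    (hwf1 : S1.WF) (hwf2 : S2.WF)
    (hfin1 : S1.FiniteSys) (hfin2 : S2.FiniteSys)
    (hhf1 : (S1.mach H).HatFree) (hhf2 : (S2.mach K).HatFree)
    (c : Config R A B) (hc : Reach (CS.compose S1 S2 H K) c) :
    (c.st H ∉ (S1.mach H).hatStates → Reach S1 c) ∧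
    (c.st K ∉ (S2.mach K).hatStates → Reach S2 c) := by
  have hd : ∀ p, p ∈ S1.roles → p ∉ S2.roles := fun p h1 h2 => by
    have : p ∈ S1.roles ∩ S2.roles := ⟨h1, h2⟩
    rw [hdisj] at this; exact this
  have hKH : K ≠ H := by rintro rfl; exact hd _ hH hK
  refine ⟨reach_side (T := CS.compose S1 S2 H K) (K := K) hH (fun h => hd _ h hK) hwf1 hhf1 (fun p hp => Or.inl hp) ?_ ?_ hc,
    reach_side (T := CS.compose S1 S2 H K) (K := H) hK (hd _ hH) hwf2 hhf2 (fun p hp => Or.inr hp) ?_ ?_ hc⟩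
  · simp [CS.compose]
  · intro p hp hpH
    have : p ≠ K := by rintro rfl; exact hd _ hp hK
    simp [CS.compose, hpH, this, hp]
  · simp [CS.compose, hKH]
  · intro p hp hpK
    have h1 : p ≠ H := by rintro rfl; exact hd _ hH hp
    have h2 : p ∉ S1.roles := fun h => hd _ h hp
    simp [CS.compose, h1, hpK, h2]
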